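/- Let p ∈ [1,∞), let (Ω, 𝒜, μ) be a measure space, let U ∈ 𝒜, let I ⊂ ℝ be a compact interval, let δ > 0 and let I_δ := {t ∈ ℝ : dist(t,I) ≤ δ}. Let (E_k)_{k∈ℕ} be pairwise disjoint Lebesgue-measurable subsets of ℝ and g_k : Ω → [0,∞) measurable with ∫_U g_k^p dμ < ∞ for each k, and assume Σ_k λ(E_k ∩ I_δ)^{1/p} · ‖g_k‖_{L^p(U,μ)} < ∞. Then lim_{s→0} Σ_k ( ∫_I |1_{E_k}(t−s) − 1_{E_k}(t)|^p dt )^{1/p} · ‖g_k‖_{L^p(U,μ)} = 0, and consequently lim_{s→0} ∫_I ∫_U ( Σ_k |1_{E_k}(t−s) − 1_{E_k}(t)|·g_k(x) )^p dμ(x) dt = 0. -/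

import Mathlib

open MeasureTheory Filter Set
open scoped ENNReal Topology symmDiff

theorem lintegral_rpow_tsum_le {α : Type*} [MeasurableSpace α] (μ : Measure α) {p : ℝ}
    (hp : 1 ≤ p) {f : ℕ → α → ℝ≥0∞} (hf : ∀ k, Measurable (f k)) :
    (∫⁻ x, (∑' k, f k x) ^ p ∂μ) ^ (1 / p) ≤ ∑' k, (∫⁻ x, f k x ^ p ∂μ) ^ (1 / p) := by
  have hp0 : 0 < p := by linarith
  have h1 : ∀ n, ∫⁻ x, (∑ k ∈ Finset.range n, f k x) ^ p ∂μ
      ≤ (∑' k, (∫⁻ x, f k x ^ p ∂μ) ^ (1 / p)) ^ p := by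
    intro n
    have h := eLpNorm'_sum_le (μ := μ) (s := Finset.range n)
      (fun k _ => (hf k).aestronglyMeasurable) hp
    simp only [eLpNorm', enorm_eq_self, Finset.sum_apply] at h
    rw [← ENNReal.rpow_inv_le_iff hp0, ← one_div]
    exact h.trans (ENNReal.sum_le_tsum _)
  rw [one_div, ENNReal.rpow_inv_le_iff hp0]
  have h2 : ∀ x, (∑' k, f k x) ^ p = ⨆ n, (∑ k ∈ Finset.range n, f k x) ^ p := by
    intro x
    rw [ENNReal.tsum_eq_iSup_nat]
    exact (ENNReal.orderIsoRpow p hp0).map_iSup _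
  simp_rw [h2]
  rw [lintegral_iSup]
  · simpa only [one_div] using iSup_le h1
  · intro n
    exact (Finset.measurable_sum _ fun k _ => hf k).pow_const p
  · intro m n hmn x
    exact ENNReal.rpow_le_rpow
      (Finset.sum_le_sum_of_subset (Finset.range_mono hmn)) hp0.le

theorem lintegral_mul_rpow {α : Type*} [MeasurableSpace α] {μ : Measure α} {p : ℝ}
    (hp : 0 < p) (c : ℝ≥0∞) {f : α → ℝ≥0∞} (hf : Measurable f) :
    (∫⁻ x, (c * f x) ^ p ∂μ) ^ (1 / p) = c * (∫⁻ x, f x ^ p ∂μ) ^ (1 / p) := by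
  simp_rw [ENNReal.mul_rpow_of_nonneg _ _ hp.le]
  rw [lintegral_const_mul _ (hf.pow_const p), ENNReal.mul_rpow_of_nonneg _ _ (by positivity),
    one_div, ENNReal.rpow_rpow_inv hp.ne']

theorem ENNReal.tendsto_tsum_zero_of_dominated {ι : Type*} {l : Filter ι}
    [l.IsCountablyGenerated] {F : ι → ℕ → ℝ≥0∞} {B : ℕ → ℝ≥0∞} (hB : ∑' k, B k ≠ ⊤)
    (hle : ∀ᶠ s in l, ∀ k, F s k ≤ B k) (hF : ∀ k, Tendsto (F · k) l (𝓝 0)) :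
    Tendsto (fun s => ∑' k, F s k) l (𝓝 0) := by
  have h := tendsto_lintegral_filter_of_dominated_convergence (μ := Measure.count)
    (l := l) (F := F) (f := fun _ => 0) B (.of_forall fun s => measurable_from_nat)
    (hle.mono fun s hs => .of_forall hs) (by rwa [lintegral_count])
    (.of_forall hF)
  simpa [lintegral_count] using h

theorem ofReal_abs_indicator_sub_rpow {p : ℝ} (hp : 0 < p) (E : Set ℝ) (s t : ℝ) :
    ENNReal.ofReal (|E.indicator (fun _ => (1 : ℝ)) (t - s)
      - E.indicator (fun _ => (1 : ℝ)) t| ^ p)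
      = (((· - s) ⁻¹' E) ∆ E).indicator 1 t := by
  by_cases h1 : t - s ∈ E <;> by_cases h2 : t ∈ E <;>
    simp [h1, h2, Set.indicator, Set.mem_symmDiff, hp.ne']

theorem tendsto_measure_symmDiff_translate {F : Set ℝ} (hF : MeasurableSet F)
    (hF' : volume F ≠ ⊤) :
    Tendsto (fun s : ℝ => volume (((· - s) ⁻¹' F) ∆ F)) (𝓝 0) (𝓝 0) := by
  have h := tendsto_measure_symmDiff_preimage_nhds_zero (μ := volume) (ν := volume)
    (l := 𝓝 (0 : ℝ)) (f := fun s : ℝ => (⟨(· - s), by fun_prop⟩ : C(ℝ, ℝ)))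
    (g := ContinuousMap.id ℝ)
    (by
      have hc : Continuous (fun s : ℝ => (⟨(· - s), by fun_prop⟩ : C(ℝ, ℝ))) :=
        ContinuousMap.continuous_of_continuous_uncurry _ (by
          change Continuous fun q : ℝ × ℝ => q.2 - q.1
          fun_prop)
      have := hc.tendsto 0
      convert this using 2
      ext x
      simp)
    (.of_forall fun s => by simpa using measurePreserving_sub_right volume s)
    (MeasurePreserving.id volume) hF.nullMeasurableSet hF'
  simpa using h

theorem lintegral_translate_indicator_le {p : ℝ} (hp : 0 < p) {E : Set ℝ}
    (hE : MeasurableSet E) {a b δ s : ℝ} (hs : |s| ≤ δ) :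
    ∫⁻ t in Icc a b, ENNReal.ofReal (|E.indicator (fun _ => (1 : ℝ)) (t - s)
      - E.indicator (fun _ => (1 : ℝ)) t| ^ p)
      ≤ volume (((· - s) ⁻¹' (E ∩ Icc (a - δ) (b + δ))) ∆ (E ∩ Icc (a - δ) (b + δ))) := by
  have hm : MeasurableSet (((· - s) ⁻¹' E) ∆ E) :=
    (hE.preimage (measurable_id.sub_const s)).symmDiff hE
  simp_rw [ofReal_abs_indicator_sub_rpow hp]
  rw [lintegral_indicator_one hm, Measure.restrict_apply hm]
  refine measure_mono fun t ⟨ht, hta, htb⟩ => ?_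
  obtain ⟨hs1, hs2⟩ := abs_le.mp hs
  have h1 : t ∈ Icc (a - δ) (b + δ) := ⟨by linarith, by linarith⟩
  have h2 : t - s ∈ Icc (a - δ) (b + δ) := ⟨by linarith, by linarith⟩
  simp only [Set.mem_symmDiff, mem_preimage, mem_inter_iff, h1, h2, and_true] at ht ⊢
  exact ht

/-- Let `I = [a,b]` be a compact interval, `δ > 0`,
`I_δ = [a−δ, b+δ]`, let the `E_k ⊆ ℝ` be pairwise disjoint and Lebesgue measurable and
`g_k : Ω → [0,∞)` measurable with `∫_U g_k^p dμ < ∞` and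
`Σ_k λ(E_k ∩ I_δ)^{1/p}·‖g_k‖_{L^p(U,μ)} < ∞`. Then
`Σ_k (∫_I |1_{E_k}(t−s) − 1_{E_k}(t)|^p dt)^{1/p}·‖g_k‖_{L^p(U,μ)} → 0` as `s → 0` and
consequently `∫_I ∫_U (Σ_k |1_{E_k}(t−s) − 1_{E_k}(t)|·g_k(x))^p dμ dt → 0` as `s → 0`. -/
theorem tendsto_lintegral_tsum_translate_indicator
    {Ω : Type*} [MeasurableSpace Ω] (μ : Measure Ω)
    (p : ℝ) (hp : 1 ≤ p)
    (U : Set Ω) (hU : MeasurableSet U)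
    (a b : ℝ) (hab : a ≤ b) (δ : ℝ) (hδ : 0 < δ)
    (E : ℕ → Set ℝ) (hEm : ∀ k, MeasurableSet (E k))
    (hEd : Pairwise (Function.onFun Disjoint E))
    (g : ℕ → Ω → ℝ) (hgm : ∀ k, Measurable (g k)) (hg0 : ∀ k x, 0 ≤ g k x)
    (hgp : ∀ k, ∫⁻ x in U, ENNReal.ofReal (g k x ^ p) ∂μ < ⊤)
    (hsum :
      ∑' k, (volume (E k ∩ Set.Icc (a - δ) (b + δ))) ^ (1 / p)
          * (∫⁻ x in U, ENNReal.ofReal (g k x ^ p) ∂μ) ^ (1 / p) < ⊤) :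
    Tendsto
      (fun s => ∑' k,
          (∫⁻ t in Set.Icc a b, ENNReal.ofReal
              (|(E k).indicator (fun _ => (1 : ℝ)) (t - s)
                  - (E k).indicator (fun _ => (1 : ℝ)) t| ^ p)) ^ (1 / p)
            * (∫⁻ x in U, ENNReal.ofReal (g k x ^ p) ∂μ) ^ (1 / p))
      (𝓝 (0 : ℝ)) (𝓝 0) ∧
    Tendsto
      (fun s => ∫⁻ t in Set.Icc a b, ∫⁻ x in U,
          (∑' k, ENNReal.ofReal
              (|(E k).indicator (fun _ => (1 : ℝ)) (t - s)
                  - (E k).indicator (fun _ => (1 : ℝ)) t| * g k x)) ^ p ∂μ)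
      (𝓝 (0 : ℝ)) (𝓝 0) := by
  have hp0 : 0 < p := by linarith
  have hp1 : 0 < 1 / p := by positivity
  have hfin : ∀ k, volume (E k ∩ Icc (a - δ) (b + δ)) ≠ ⊤ := fun k =>
    ((measure_mono inter_subset_right).trans_lt measure_Icc_lt_top).ne
  have hm : ∀ k, MeasurableSet (E k ∩ Icc (a - δ) (b + δ)) := fun k =>
    (hEm k).inter measurableSet_Icc
  have hsmall : ∀ᶠ s in 𝓝 (0 : ℝ), |s| ≤ δ := by
    filter_upwards [Metric.closedBall_mem_nhds (0 : ℝ) hδ] with s hs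
    simpa using hs
  have key : Tendsto
      (fun s => ∑' k,
          (∫⁻ t in Set.Icc a b, ENNReal.ofReal
              (|(E k).indicator (fun _ => (1 : ℝ)) (t - s)
                  - (E k).indicator (fun _ => (1 : ℝ)) t| ^ p)) ^ (1 / p)
            * (∫⁻ x in U, ENNReal.ofReal (g k x ^ p) ∂μ) ^ (1 / p))
      (𝓝 (0 : ℝ)) (𝓝 0) := by
    refine ENNReal.tendsto_tsum_zero_of_dominated
      (B := fun k => 2 ^ (1 / p) * ((volume (E k ∩ Set.Icc (a - δ) (b + δ))) ^ (1 / p)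
          * (∫⁻ x in U, ENNReal.ofReal (g k x ^ p) ∂μ) ^ (1 / p))) ?_ ?_ fun k => ?_
    · rw [ENNReal.tsum_mul_left]
      exact ENNReal.mul_ne_top (ENNReal.rpow_ne_top_of_nonneg hp1.le (by simp)) hsum.ne
    · filter_upwards [hsmall] with s hs k
      rw [← mul_assoc, ← ENNReal.mul_rpow_of_nonneg 2 _ hp1.le]
      gcongr
      refine (lintegral_translate_indicator_le hp0 (hEm k) hs).trans ?_
      refine (measure_mono symmDiff_le_sup).trans ((measure_union_le _ _).trans_eq ?_)
      rw [(measurePreserving_sub_right volume s).measure_preimage (hm k).nullMeasurableSet,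
        two_mul]
    · have hA := tendsto_of_tendsto_of_tendsto_of_le_of_le' tendsto_const_nhds
        (tendsto_measure_symmDiff_translate (hm k) (hfin k))
        (.of_forall fun s => zero_le)
        (hsmall.mono fun s hs => lintegral_translate_indicator_le hp0 (hEm k) hs)
      have hA' := hA.ennrpow_const (1 / p)
      rw [ENNReal.zero_rpow_of_pos hp1] at hA'
      simpa using ENNReal.Tendsto.mul_const hA'
        (Or.inr (ENNReal.rpow_ne_top_of_nonneg hp1.le (hgp k).ne))
  refine ⟨key, ?_⟩
  have key' := key.ennrpow_const p
  rw [ENNReal.zero_rpow_of_pos hp0] at key'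
  refine tendsto_of_tendsto_of_tendsto_of_le_of_le tendsto_const_nhds key'
    (fun s => zero_le) fun s => ?_
  have hc : ∀ k, Measurable fun t => ENNReal.ofReal
      |(E k).indicator (fun _ => (1 : ℝ)) (t - s) - (E k).indicator (fun _ => (1 : ℝ)) t| := by
    intro k
    have hi : Measurable ((E k).indicator fun _ => (1 : ℝ)) :=
      measurable_const.indicator (hEm k)
    exact ((hi.comp (measurable_id.sub_const s)).sub hi).abs.ennreal_ofReal
  have hinner : ∀ t, ∫⁻ x in U,
        (∑' k, ENNReal.ofReal
            (|(E k).indicator (fun _ => (1 : ℝ)) (t - s)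
                - (E k).indicator (fun _ => (1 : ℝ)) t| * g k x)) ^ p ∂μ
      ≤ (∑' k, ENNReal.ofReal
            |(E k).indicator (fun _ => (1 : ℝ)) (t - s)
                - (E k).indicator (fun _ => (1 : ℝ)) t|
          * (∫⁻ x in U, ENNReal.ofReal (g k x ^ p) ∂μ) ^ (1 / p)) ^ p := by
    intro t
    have h := lintegral_rpow_tsum_le (μ.restrict U) hp
      (f := fun k x => ENNReal.ofReal |(E k).indicator (fun _ => (1 : ℝ)) (t - s)
        - (E k).indicator (fun _ => (1 : ℝ)) t| * ENNReal.ofReal (g k x))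
      (fun k => (hgm k).ennreal_ofReal.const_mul _)
    simp only [lintegral_mul_rpow hp0 _ (hgm _).ennreal_ofReal,
      ENNReal.ofReal_rpow_of_nonneg (hg0 _ _) hp0.le] at h
    simp only [ENNReal.ofReal_mul (abs_nonneg _)]
    rwa [one_div, ENNReal.rpow_inv_le_iff hp0, ← one_div] at h
  refine (lintegral_mono hinner).trans ?_
  have h := lintegral_rpow_tsum_le (volume.restrict (Icc a b)) hp
    (f := fun k t => (∫⁻ x in U, ENNReal.ofReal (g k x ^ p) ∂μ) ^ (1 / p) * ENNReal.ofReal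
      |(E k).indicator (fun _ => (1 : ℝ)) (t - s) - (E k).indicator (fun _ => (1 : ℝ)) t|)
    (fun k => (hc k).const_mul _)
  simp only [lintegral_mul_rpow hp0 _ (hc _),
    ENNReal.ofReal_rpow_of_nonneg (abs_nonneg _) hp0.le] at h
  rw [one_div, ENNReal.rpow_inv_le_iff hp0, ← one_div] at h
  simpa only [mul_comm] using h
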